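/- Let n be a positive integer, δ := d_n/n with d_n a positive rational, and let τ = {τ_i=(δ, i·δ, p_i): 1 ≤ i ≤ n} be constrained-deadline tasks with positive rational periods p_i satisfying: dbf(τ,t) ≤ t for all t > 0, and d_i + p_i > d_n for all 1 ≤ i ≤ n−1 (where d_i = i·δ). Then there exist positive rationals p'_1,…,p'_n with p'_i ≤ p_i for all i such that the task set τ' = {τ'_i=(δ, i·δ, p'_i): 1 ≤ i ≤ n} satisfies: τ' is aligned, i.e., there is a permutation π of {1,…,n} with d_{π(i)} + p'_{π(i)} = d_n + d_i for all i; f(τ',t) ≤ t for all t > 0; and dbf*(τ', d_n) ≥ dbf*(τ, d_n). -/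

import Mathlib

open Finset

/-- Demand bound function of a task `(e, d, p)` at time `t`. -/
noncomputable def dbf (e d p t : ℝ) : ℝ :=
  if t < d then 0 else ((⌊(t - d) / p⌋ : ℝ) + 1) * e

/-- Approximate demand bound function of a task `(e, d, p)` at time `t`. -/
noncomputable def dbfStar (e d p t : ℝ) : ℝ :=
  if t < d then 0 else ((t - d) / p + 1) * e

/-- Modified demand function `f` of a task `(e, d, p)` at time `t`. -/
noncomputable def fmod (e d p t : ℝ) : ℝ :=
  if t < d + p then dbf e d p t else 2 * e

/-- If the first job of a task has its deadline by time `t`, its demand is at least one job. -/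
lemma le_dbf {e d p t : ℝ} (he : 0 ≤ e) (hp : 0 < p) (hd : d ≤ t) : e ≤ dbf e d p t := by
  rw [dbf, if_neg hd.not_gt]
  have h : (0 : ℤ) ≤ ⌊(t - d) / p⌋ := Int.floor_nonneg.2 (div_nonneg (by linarith) hp.le)
  have h' : (0 : ℝ) ≤ (⌊(t - d) / p⌋ : ℝ) := by exact_mod_cast h
  nlinarith

/-- If the second job of a task has its deadline by time `t`, its demand is at least two jobs. -/
lemma two_mul_le_dbf {e d p t : ℝ} (he : 0 ≤ e) (hp : 0 < p) (hd : d + p ≤ t) :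
    2 * e ≤ dbf e d p t := by
  rw [dbf, if_neg (by linarith)]
  have h : (1 : ℤ) ≤ ⌊(t - d) / p⌋ := by
    rw [Int.le_floor, le_div_iff₀ hp]
    push_cast
    linarith
  have h' : (1 : ℝ) ≤ (⌊(t - d) / p⌋ : ℝ) := by exact_mod_cast h
  nlinarith

/-- The modified demand counts the deadlines among the first two jobs. -/
lemma fmod_eq {e d p t : ℝ} (hp : 0 < p) :
    fmod e d p t = (if d ≤ t then e else 0) + (if d + p ≤ t then e else 0) := by
  unfold fmod dbf
  rcases lt_or_ge t d with h1 | h1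
  · rw [if_pos (by linarith), if_pos h1, if_neg h1.not_ge, if_neg (by linarith), add_zero]
  · rcases lt_or_ge t (d + p) with h2 | h2
    · have h : ⌊(t - d) / p⌋ = 0 := by
        rw [Int.floor_eq_zero_iff]
        exact ⟨div_nonneg (by linarith) hp.le, by rw [div_lt_one hp]; linarith⟩
      rw [if_pos h2, if_neg h1.not_gt, if_pos h1, if_neg h2.not_ge, h]
      simp
    · rw [if_neg h2.not_gt, if_pos h1, if_pos h2, two_mul]

/-- The approximate demand is antitone in the period. -/
lemma dbfStar_anti {e d p q t : ℝ} (he : 0 ≤ e) (hq : 0 < q) (hqp : q ≤ p) :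
    dbfStar e d p t ≤ dbfStar e d q t := by
  unfold dbfStar
  split_ifs with h
  · exact le_rfl
  · have : 0 ≤ t - d := by linarith
    gcongr

/-- The positive multiples of `δ` up to `t` number at most `t / δ`. -/
lemma sum_ite_mul_le {δ t : ℝ} (ht : 0 ≤ t) (hδ : 0 ≤ δ) (m : ℕ) :
    ∑ k ∈ Finset.Icc 1 m, (if (k : ℝ) * δ ≤ t then δ else 0) ≤ t := by
  induction m with
  | zero => simpa using ht
  | succ m ih =>
    by_cases h : ((m + 1 : ℕ) : ℝ) * δ ≤ t
    · calc ∑ k ∈ Finset.Icc 1 (m + 1), (if (k : ℝ) * δ ≤ t then δ else 0)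
          ≤ ∑ _k ∈ Finset.Icc 1 (m + 1), δ :=
            Finset.sum_le_sum fun k _ => by split_ifs <;> linarith
        _ = ((m + 1 : ℕ) : ℝ) * δ := by simp
        _ ≤ t := h
    · rw [Finset.sum_Icc_succ_top (by omega), if_neg h, add_zero]
      exact ih

/-- Every function on `{1, …, n}` is sorted by a permutation. -/
lemma exists_perm_monotoneOn_Icc {α : Type*} [LinearOrder α] (n : ℕ) (g : ℕ → α) :
    ∃ π : Equiv.Perm ℕ, (∀ i ∈ Finset.Icc 1 n, π i ∈ Finset.Icc 1 n) ∧
      MonotoneOn (g ∘ π) (Finset.Icc 1 n : Finset ℕ) := by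
  let E : Fin n ≃ {x : ℕ // x ∈ Finset.Icc 1 n} :=
    { toFun := fun i => ⟨i + 1, Finset.mem_Icc.2 ⟨by omega, by omega⟩⟩
      invFun := fun x => ⟨x.1 - 1, by have := Finset.mem_Icc.1 x.2; omega⟩
      left_inv := fun i => by ext; simp
      right_inv := fun x => by
        have := Finset.mem_Icc.1 x.2
        ext
        simp only
        omega }
  have hE (x : ℕ) (hx : x ∈ Finset.Icc 1 n) : ∃ a : Fin n, (E a : ℕ) = x ∧ (a : ℕ) + 1 = x := by
    have := congrArg Subtype.val (E.apply_symm_apply ⟨x, hx⟩)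
    exact ⟨E.symm ⟨x, hx⟩, this, this⟩
  let σ := Tuple.sort fun a : Fin n => g (E a)
  refine ⟨σ.extendDomain E, fun i hi => ?_, fun i hi j hj hij => ?_⟩
  · obtain ⟨a, rfl, -⟩ := hE i hi
    rw [Equiv.Perm.extendDomain_apply_image]
    exact (E (σ a)).2
  · obtain ⟨a, rfl, ha⟩ := hE i hi
    obtain ⟨b, rfl, hb⟩ := hE j hj
    simp only [Function.comp_apply, Equiv.Perm.extendDomain_apply_image]
    exact Tuple.monotone_sort (fun a : Fin n => g (E a)) (show a ≤ b by rw [Fin.le_def]; omega)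

/-- For constrained-deadline tasks `τ_i = (δ, i·δ, p_i)` with `δ = d_n/n`
(positive rational parameters) satisfying `dbf(τ,t) ≤ t` and `d_i + p_i > d_n` for
`i ≤ n−1`, there exist positive rational periods `p'_i ≤ p_i` such that
`τ' = {(δ, i·δ, p'_i)}` is aligned, satisfies `f(τ',t) ≤ t` for all `t > 0`, and
`dbf*(τ', d_n) ≥ dbf*(τ, d_n)`. -/
theorem stmt10 (n : ℕ) (hn : 0 < n) (dn : ℚ) (hdn : 0 < dn)
    (p : ℕ → ℚ) (hp : ∀ i ∈ Finset.Icc 1 n, 0 < p i)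
    (hcd : ∀ i ∈ Finset.Icc 1 n, (i : ℚ) * (dn / (n : ℚ)) ≤ p i)
    (hdbf : ∀ t : ℝ, 0 < t →
      ∑ i ∈ Finset.Icc 1 n,
        dbf ((dn / (n : ℚ) : ℚ) : ℝ) (((i : ℚ) * (dn / (n : ℚ)) : ℚ) : ℝ) ((p i : ℝ)) t ≤ t)
    (hdp : ∀ i ∈ Finset.Icc 1 (n - 1), (i : ℚ) * (dn / (n : ℚ)) + p i > dn) :
    ∃ p' : ℕ → ℚ,
      (∀ i ∈ Finset.Icc 1 n, 0 < p' i) ∧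
      (∀ i ∈ Finset.Icc 1 n, p' i ≤ p i) ∧
      (∃ π : Equiv.Perm ℕ, (∀ i ∈ Finset.Icc 1 n, π i ∈ Finset.Icc 1 n) ∧
        ∀ i ∈ Finset.Icc 1 n,
          (π i : ℚ) * (dn / (n : ℚ)) + p' (π i) = dn + (i : ℚ) * (dn / (n : ℚ))) ∧
      (∀ t : ℝ, 0 < t →
        ∑ i ∈ Finset.Icc 1 n,
          fmod ((dn / (n : ℚ) : ℚ) : ℝ) (((i : ℚ) * (dn / (n : ℚ)) : ℚ) : ℝ)
            ((p' i : ℝ)) t ≤ t) ∧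
      ∑ i ∈ Finset.Icc 1 n,
          dbfStar ((dn / (n : ℚ) : ℚ) : ℝ) (((i : ℚ) * (dn / (n : ℚ)) : ℚ) : ℝ)
            ((p' i : ℝ)) ((dn : ℝ)) ≥
        ∑ i ∈ Finset.Icc 1 n,
          dbfStar ((dn / (n : ℚ) : ℚ) : ℝ) (((i : ℚ) * (dn / (n : ℚ)) : ℚ) : ℝ)
            ((p i : ℝ)) ((dn : ℝ)) := by
  set δ : ℚ := dn / (n : ℚ) with hδ_def
  have hn' : (0 : ℚ) < n := by exact_mod_cast hn
  have hδ : 0 < δ := div_pos hdn hn'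
  have hnδ : (n : ℚ) * δ = dn := by rw [hδ_def]; field_simp
  have hδR : (0 : ℝ) < (δ : ℝ) := by exact_mod_cast hδ
  have hnδR : (n : ℝ) * (δ : ℝ) = dn := by exact_mod_cast hnδ
  have hpR : ∀ i ∈ Finset.Icc 1 n, (0 : ℝ) < (p i : ℝ) := fun i hi => by exact_mod_cast hp i hi
  have hsecond : ∀ i ∈ Finset.Icc 1 n, dn < (i : ℚ) * δ + p i := by
    intro i hi
    rcases eq_or_ne i n with rfl | hne
    · linarith [hp i hi]
    · rw [Finset.mem_Icc] at hi
      exact hdp i (Finset.mem_Icc.2 ⟨hi.1, by omega⟩)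
  obtain ⟨π, hπ, hmono⟩ := exists_perm_monotoneOn_Icc n fun i => (i : ℚ) * δ + p i
  have hsurj : ∀ j ∈ Finset.Icc 1 n, ∃ i ∈ Finset.Icc 1 n, π i = j := fun j hj =>
    Finset.surj_on_of_inj_on_of_card_le (fun i _ => π i) hπ
      (fun _ _ _ _ h => π.injective h) le_rfl j hj |>.imp fun i h => ⟨h.1, h.2.symm⟩
  have hreindex (F : ℕ → ℝ) :
      ∑ i ∈ Finset.Icc 1 n, F (π i) = ∑ j ∈ Finset.Icc 1 n, F j :=
    Finset.sum_bij (fun i _ => π i) hπ (fun _ _ _ _ h => π.injective h)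
      (fun j hj => by simpa using hsurj j hj) fun _ _ => rfl
  have hrank : ∀ i ∈ Finset.Icc 1 n, dn + (i : ℚ) * δ ≤ (π i : ℚ) * δ + p (π i) := by
    intro i hi
    have hi' := Finset.mem_Icc.1 hi
    set T : ℚ := (π i : ℚ) * δ + p (π i) with hT
    have hdT : dn < T := hsecond _ (hπ i hi)
    have hdTR : (dn : ℝ) < T := by exact_mod_cast hdT
    have hdnR : (0 : ℝ) < dn := by exact_mod_cast hdn
    have hle := hdbf T (by linarith)
    rw [← hreindex] at hle
    have hlow : ∑ k ∈ Finset.Icc 1 n, ((δ : ℝ) + if k ≤ i then (δ : ℝ) else 0) ≤ T := by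
      refine (Finset.sum_le_sum fun k hk => ?_).trans hle
      have hpk := hpR _ (hπ k hk)
      split_ifs with hki
      · rw [← two_mul]
        refine two_mul_le_dbf hδR.le hpk ?_
        exact_mod_cast hmono hk hi hki
      · rw [add_zero]
        refine le_dbf hδR.le hpk ?_
        have hkn : ((π k : ℕ) : ℚ) ≤ n := by exact_mod_cast (Finset.mem_Icc.1 (hπ k hk)).2
        have : (π k : ℚ) * δ ≤ T := by nlinarith
        exact_mod_cast this
    have hfilter : (Finset.Icc 1 n).filter (fun k => k ≤ i) = Finset.Icc 1 i := by
      ext k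
      simp only [Finset.mem_filter, Finset.mem_Icc]
      omega
    rw [Finset.sum_add_distrib, ← Finset.sum_filter, hfilter] at hlow
    simp only [Finset.sum_const, Nat.card_Icc, Nat.add_sub_cancel, nsmul_eq_mul] at hlow
    rw [hnδR] at hlow
    exact_mod_cast hlow
  have hpos : ∀ j ∈ Finset.Icc 1 n, 0 < dn + (π.symm j : ℚ) * δ - (j : ℚ) * δ := by
    intro j hj
    obtain ⟨i, hi, rfl⟩ := hsurj j hj
    rw [Equiv.symm_apply_apply]
    have h1 : ((π i : ℕ) : ℚ) ≤ n := by exact_mod_cast (Finset.mem_Icc.1 (hπ i hi)).2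
    have h2 : (1 : ℚ) ≤ i := by exact_mod_cast (Finset.mem_Icc.1 hi).1
    nlinarith
  have hle : ∀ j ∈ Finset.Icc 1 n, dn + (π.symm j : ℚ) * δ - (j : ℚ) * δ ≤ p j := by
    intro j hj
    obtain ⟨i, hi, rfl⟩ := hsurj j hj
    rw [Equiv.symm_apply_apply]
    linarith [hrank i hi]
  refine ⟨fun j => dn + (π.symm j : ℚ) * δ - (j : ℚ) * δ, hpos, hle, ⟨π, hπ, fun i _ => ?_⟩,
    fun t ht => ?_, Finset.sum_le_sum fun i hi => ?_⟩
  · simp only [Equiv.symm_apply_apply]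
    ring
  · rw [Finset.sum_congr rfl fun j hj => fmod_eq (by exact_mod_cast hpos j hj),
      Finset.sum_add_distrib]
    rw [← hreindex fun j => if (((j : ℚ) * δ : ℚ) : ℝ) +
      ((dn + (π.symm j : ℚ) * δ - (j : ℚ) * δ : ℚ) : ℝ) ≤ t then (δ : ℝ) else 0]
    have hdeadline (i : ℕ) : (((π i : ℚ) * δ : ℚ) : ℝ) +
        ((dn + (π.symm (π i) : ℚ) * δ - (π i : ℚ) * δ : ℚ) : ℝ) = dn + (i : ℝ) * δ := by
      rw [Equiv.symm_apply_apply]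
      push_cast
      ring
    simp only [hdeadline]
    push_cast
    rcases lt_or_ge t dn with h | h
    · rw [Finset.sum_eq_zero (s := Finset.Icc 1 n)
        (f := fun i : ℕ => if (dn : ℝ) + i * δ ≤ t then (δ : ℝ) else 0) fun i _ => if_neg ?_,
        add_zero]
      · exact sum_ite_mul_le ht.le hδR.le n
      · have : (0 : ℝ) ≤ i * δ := by positivity
        linarith
    · have h1 : ∑ i ∈ Finset.Icc 1 n, (if (i : ℝ) * δ ≤ t then (δ : ℝ) else 0) ≤ dn :=
        calc ∑ i ∈ Finset.Icc 1 n, (if (i : ℝ) * δ ≤ t then (δ : ℝ) else 0)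
            ≤ ∑ _i ∈ Finset.Icc 1 n, (δ : ℝ) :=
              Finset.sum_le_sum fun i _ => by split_ifs <;> linarith
          _ = dn := by simp [hnδR]
      have h2 := sum_ite_mul_le (sub_nonneg.2 h) hδR.le n
      simp only [le_sub_iff_add_le'] at h2
      linarith
  · exact dbfStar_anti hδR.le (by exact_mod_cast hpos i hi) (by exact_mod_cast hle i hi)
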